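/- Let (R,Λ,S) be a generalised Renner–Coxeter system with length function ℓ, r ∈ R with normal decomposition (w₁,e,w₂), and f ∈ Λ. If ℓ(rf) = ℓ(r), then w₂ ∈ W_{λ(f)}. Moreover, for s ∈ S: if ℓ(sr) = ℓ(r)−1 then ℓ(srf) ≤ ℓ(rf), and if ℓ(sr) = ℓ(r)+1 then ℓ(srf) ≥ ℓ(rf). -/

import Mathlib

noncomputable section

/-- A generalised Renner–Coxeter system on a monoid `R`: a Coxeter system `(Rˣ, S)` on the unit
group (indexed by `B`, with data `cm`, `cs`), a cross-section semilattice `Λ` of idempotents,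
and type maps `lam = λ`, `lamStar = λ_⋆` satisfying axioms (ECS1)–(ECS6). -/
structure GRCSystem (B : Type*) (R : Type*) [Monoid R] where
  /-- The Coxeter matrix indexing the simple reflections `S`. -/
  cm : CoxeterMatrix B
  /-- (ECS3): the unit group of `R` is a Coxeter group. -/
  cs : CoxeterSystem cm Rˣ
  /-- The cross-section lattice `Λ`. -/
  Λ : Set R
  /-- The type map `λ`, with `W(e) = W_{λ(e)}`. -/
  lam : R → Set B
  /-- The map `λ_⋆`, with `W_⋆(e) = W_{λ_⋆(e)}`. -/
  lamStar : R → Set B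
  /-- (ECS1): idempotents commute, i.e. `E(R)` is a (lower) semilattice. -/
  idem_mul_comm : ∀ e f : R, IsIdempotentElem e → IsIdempotentElem f → e * f = f * e
  /-- (ECS1): `R` is unit regular (factorisable). -/
  factor : ∀ r : R, ∃ (e : R) (g : Rˣ), IsIdempotentElem e ∧ r = e * (g : R)
  /-- (ECS2): elements of `Λ` are idempotent. -/
  lam_idem : ∀ e ∈ Λ, IsIdempotentElem e
  /-- (ECS2): `Λ` is a sub-semilattice of `E(R)`. -/
  lam_mul_mem : ∀ e ∈ Λ, ∀ f ∈ Λ, e * f ∈ Λ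
  /-- (ECS2): `Λ` is a transversal of `E(R)` for the conjugation action of the unit group. -/
  transversal : ∀ e : R, IsIdempotentElem e →
    ∃! f : R, f ∈ Λ ∧ ∃ w : Rˣ, (w : R) * f * ((w⁻¹ : Rˣ) : R) = e
  /-- (ECS4): comparable idempotents are simultaneously conjugate to a comparable pair in `Λ`. -/
  ecs4 : ∀ e₁ e₂ : R, IsIdempotentElem e₁ → IsIdempotentElem e₂ →
    e₁ * e₂ = e₁ → e₂ * e₁ = e₁ →
    ∃ (w : Rˣ) (f₁ f₂ : R), f₁ ∈ Λ ∧ f₂ ∈ Λ ∧ f₁ * f₂ = f₁ ∧ f₂ * f₁ = f₁ ∧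
      (w : R) * f₁ * ((w⁻¹ : Rˣ) : R) = e₁ ∧ (w : R) * f₂ * ((w⁻¹ : Rˣ) : R) = e₂
  /-- (ECS5): `W(e)` is the standard parabolic subgroup on `λ(e)`. -/
  mem_lam_iff : ∀ e ∈ Λ, ∀ w : Rˣ,
    ((w : R) * e = e * (w : R)) ↔ w ∈ Subgroup.closure (cs.simple '' lam e)
  /-- (ECS5): `W_⋆(e)` is the standard parabolic subgroup on `λ_⋆(e)`. -/
  mem_lamStar_iff : ∀ e ∈ Λ, ∀ w : Rˣ,
    ((w : R) * e = e ∧ e * (w : R) = e) ↔ w ∈ Subgroup.closure (cs.simple '' lamStar e)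
  /-- (ECS6): the map `e ↦ λ^⋆(e)` is order preserving. -/
  ecs6 : ∀ e ∈ Λ, ∀ f ∈ Λ, e * f = e →
    ∀ s : B, ((cs.simple s : R) * e = e * (cs.simple s : R) ∧ (cs.simple s : R) * e ≠ e) →
      ((cs.simple s : R) * f = f * (cs.simple s : R) ∧ (cs.simple s : R) * f ≠ f)

namespace GRCSystem

variable {B R : Type*} [Monoid R] (G : GRCSystem B R)

/-- The standard parabolic subgroup `W_I` of the unit group of `R`. -/
def parab (I : Set B) : Subgroup Rˣ := Subgroup.closure (G.cs.simple '' I)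

/-- The set `λ^⋆(e) = {s ∈ S : s e = e s ≠ e}`. -/
def lamCostar (e : R) : Set B :=
  {s : B | (G.cs.simple s : R) * e = e * (G.cs.simple s : R) ∧ (G.cs.simple s : R) * e ≠ e}

/-- Value in `R` of a letter of the alphabet `S ⊔ R`. -/
def letterVal : B ⊕ R → R := Sum.elim (fun s => ((G.cs.simple s : Rˣ) : R)) id

/-- A word on the alphabet `S ∪ (Λ ∖ {1})`: every `inr` letter is a nonidentity element of `Λ`. -/
def IsWord (l : List (B ⊕ R)) : Prop := ∀ e : R, Sum.inr e ∈ l → e ∈ G.Λ ∧ e ≠ 1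

/-- The length of a word: letters from `S` count 1, letters from `Λ` count 0. -/
def wordLen (l : List (B ⊕ R)) : ℕ := (l.filter Sum.isLeft).length

/-- The length `ℓ(r)`: the minimal length of a word on `S ∪ (Λ ∖ {1})` representing `r`. -/
def len (r : R) : ℕ :=
  sInf {n : ℕ | ∃ l : List (B ⊕ R), G.IsWord l ∧ (l.map G.letterVal).prod = r ∧ n = wordLen l}

/-- `(w₁, e, w₂)` is the normal decomposition of `r`: `e ∈ Λ`, `w₁` is `(∅, λ_⋆(e))`-reduced
(minimal length in `w₁ W_{λ_⋆(e)}`), `w₂` is `(λ(e), ∅)`-reduced (minimal length in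
`W_{λ(e)} w₂`), and `r = w₁ e w₂`. -/
def IsNormalDecomp (r : R) (w₁ : Rˣ) (e : R) (w₂ : Rˣ) : Prop :=
  e ∈ G.Λ ∧
  (∀ u ∈ G.parab (G.lamStar e), G.cs.length w₁ ≤ G.cs.length (w₁ * u)) ∧
  (∀ u ∈ G.parab (G.lam e), G.cs.length w₂ ≤ G.cs.length (u * w₂)) ∧
  r = (w₁ : R) * e * (w₂ : R)

/-- `w` is `(I,J)`-reduced: `w` has minimal length in the double coset `W_I w W_J`. -/
def IsRed (I J : Set B) (w : Rˣ) : Prop :=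
  ∀ u ∈ G.parab I, ∀ v ∈ G.parab J, G.cs.length w ≤ G.cs.length (u * w * v)

end GRCSystem

namespace CoxeterSystem

variable {B W : Type*} [Group W] {M : CoxeterMatrix B} (cs : CoxeterSystem M W)

open scoped Classical in
/-- The action of a simple reflection on `W × ℤ/2` which conjugates the first coordinate and flips
the second one exactly at the reflection itself. -/
def flipAction (i : B) : Function.End (W × ZMod 2) := fun p =>
  (cs.simple i * p.1 * cs.simple i, p.2 + if p.1 = cs.simple i then 1 else 0)

open scoped Classical in
lemma prod_map_flipAction_reverse (ω : List B) (p : W × ZMod 2) :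
    (ω.reverse.map cs.flipAction).prod p =
      ((cs.wordProd ω)⁻¹ * p.1 * cs.wordProd ω, p.2 + (cs.leftInvSeq ω).count p.1) := by
  induction ω generalizing p with
  | nil =>
    simp only [List.reverse_nil, List.map_nil, List.prod_nil, wordProd_nil, leftInvSeq_nil,
      List.count_nil, inv_one, one_mul, mul_one, Nat.cast_zero, add_zero]
    rfl
  | cons i ω ih =>
    have hcount : ((cs.leftInvSeq ω).map (MulAut.conj (cs.simple i))).count p.1 =
        (cs.leftInvSeq ω).count (cs.simple i * p.1 * cs.simple i) := by
      have hp : p.1 = MulAut.conj (cs.simple i) (cs.simple i * p.1 * cs.simple i) := by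
        simp [mul_assoc]
      conv_lhs => rw [hp]
      exact List.count_map_of_injective _ _ (MulAut.conj (cs.simple i)).injective _
    have hstep : ((i :: ω).reverse.map cs.flipAction).prod p =
        (ω.reverse.map cs.flipAction).prod (cs.flipAction i p) := by
      simp only [List.reverse_cons, List.map_append, List.prod_append, List.map_cons, List.map_nil,
        List.prod_singleton]
      rfl
    rw [hstep, ih, leftInvSeq, List.count_cons, hcount]
    refine Prod.ext ?_ ?_
    · simp [flipAction, wordProd_cons, mul_assoc]
    · simp only [flipAction, beq_iff_eq, eq_comm (a := p.1)]
      push_cast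
      ring

open scoped Classical in
lemma even_count_leftInvSeq_alternatingWord (i j : B) (t : W) :
    Even ((cs.leftInvSeq (alternatingWord i j (2 * M i j))).count t) := by
  set L := cs.leftInvSeq (alternatingWord i j (2 * M i j)) with hL
  have hlen : L.length = 2 * M i j := by simp [hL]
  have hval (k : ℕ) (hk : k < 2 * M i j) :
      L[k]'(by omega) = cs.wordProd (alternatingWord j i (2 * k + 1)) :=
    cs.getElem_leftInvSeq_alternatingWord i j (M i j) k hk
  have hhalf : L.drop (M i j) = L.take (M i j) := by
    apply List.ext_getElem
    · simp only [List.length_drop, List.length_take, hlen]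
      omega
    · intro k hk _
      simp only [List.length_drop, hlen] at hk
      simp only [List.getElem_drop, List.getElem_take]
      rw [hval _ (by omega), hval _ (by omega), prod_alternatingWord_eq_mul_pow,
        prod_alternatingWord_eq_mul_pow]
      have h1 : (2 * (M i j + k) + 1) / 2 = M i j + k := by omega
      have h2 : (2 * k + 1) / 2 = k := by omega
      rw [h1, h2, pow_add, cs.simple_mul_simple_pow']
      simp
  rw [← List.take_append_drop (M i j) L, List.count_append, hhalf]
  exact ⟨_, rfl⟩

lemma alternatingWord_two_mul_reverse (i j : B) (m : ℕ) :
    (alternatingWord i j (2 * m)).reverse = alternatingWord j i (2 * m) := by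
  induction m with
  | zero => simp [alternatingWord]
  | succ m ih =>
    have hm : 2 * (m + 1) = 2 * m + 1 + 1 := by ring
    rw [hm, alternatingWord_succ, alternatingWord_succ, alternatingWord_succ',
      alternatingWord_succ' j i]
    simp [ih]

lemma prod_map_alternatingWord {N : Type*} [Monoid N] (g : B → N) (i j : B) (m : ℕ) :
    ((alternatingWord i j (2 * m)).map g).prod = (g i * g j) ^ m := by
  induction m with
  | zero => simp [alternatingWord]
  | succ m ih =>
    have hm : 2 * (m + 1) = 2 * m + 1 + 1 := by ring
    rw [hm, alternatingWord_succ, alternatingWord_succ]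
    simp [ih, pow_succ]

lemma isLiftable_flipAction : M.IsLiftable cs.flipAction := by
  classical
  intro i j
  funext p
  rw [← prod_map_alternatingWord, ← alternatingWord_two_mul_reverse,
    prod_map_flipAction_reverse, ← M.symmetric j i]
  have h := cs.even_count_leftInvSeq_alternatingWord j i p.1
  have hw : cs.wordProd (alternatingWord j i (2 * M j i)) = 1 := by
    rw [wordProd, prod_map_alternatingWord, simple_mul_simple_pow]
  rw [hw, (ZMod.natCast_eq_zero_iff_even).2 h, inv_one, one_mul, mul_one, add_zero]
  rfl

open scoped Classical in
lemma count_leftInvSeq_eq_of_wordProd_eq {ω ω' : List B} (h : cs.wordProd ω = cs.wordProd ω')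
    (t : W) : ((cs.leftInvSeq ω).count t : ZMod 2) = (cs.leftInvSeq ω').count t := by
  have key (ω : List B) : (ω.reverse.map cs.flipAction).prod =
      cs.lift ⟨_, cs.isLiftable_flipAction⟩ (cs.wordProd ω)⁻¹ := by
    rw [← wordProd_reverse, wordProd, map_list_prod, List.map_map]
    congr 2
    funext i
    simp [lift_apply_simple]
  have h2 := cs.prod_map_flipAction_reverse ω (t, 0)
  rw [key, h, ← key, prod_map_flipAction_reverse] at h2
  simpa using (congrArg Prod.snd h2).symm

/-- The exchange condition: a left descent of `w` occurs in the left inversion sequence of every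
word for `w`. -/
lemma IsLeftDescent.mem_leftInvSeq {ω : List B} {i : B}
    (h : cs.IsLeftDescent (cs.wordProd ω) i) : cs.simple i ∈ cs.leftInvSeq ω := by
  classical
  obtain ⟨ω', hω', hw⟩ := cs.exists_isReduced (cs.simple i * cs.wordProd ω)
  have hprod : cs.wordProd ω = cs.wordProd (i :: ω') := by
    rw [wordProd_cons, ← hw, simple_mul_simple_cancel_left]
  have hred : cs.IsReduced (i :: ω') := by
    rw [isLeftDescent_iff, hw, hω'.eq, hprod] at h
    exact h.symm
  have hcount := cs.count_leftInvSeq_eq_of_wordProd_eq hprod (cs.simple i)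
  rw [List.count_eq_one_of_mem hred.nodup_leftInvSeq (by simp [leftInvSeq])] at hcount
  by_contra hmem
  rw [List.count_eq_zero_of_not_mem hmem] at hcount
  simp at hcount

lemma leftInvSeq_append (ω ω' : List B) : cs.leftInvSeq (ω ++ ω') =
    cs.leftInvSeq ω ++ (cs.leftInvSeq ω').map (MulAut.conj (cs.wordProd ω)) := by
  induction ω with
  | nil => simp
  | cons i ω ih => simp [leftInvSeq, ih, wordProd_cons]

lemma conj_mem_leftInvSeq {a : W} {ω : List B} {i : B} (ha : ¬ cs.IsLeftDescent a i)
    (h : cs.IsLeftDescent (a * cs.wordProd ω) i) :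
    a⁻¹ * cs.simple i * a ∈ cs.leftInvSeq ω := by
  obtain ⟨ω', hω', rfl⟩ := cs.exists_isReduced a
  rw [← wordProd_append] at h
  have hmem := IsLeftDescent.mem_leftInvSeq cs h
  rw [leftInvSeq_append, List.mem_append, List.mem_map] at hmem
  rcases hmem with hmem | ⟨t, ht, hti⟩
  · exact absurd (cs.isLeftInversion_of_mem_leftInvSeq hω' hmem).2 ha
  · rw [← hti]
    simpa [mul_assoc] using ht

/-- The standard parabolic subgroup generated by the simple reflections indexed by `I`. -/
def parabolic (I : Set B) : Subgroup W := Subgroup.closure (cs.simple '' I)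

variable {cs} {I J K : Set B}

lemma simple_mem_parabolic {i : B} (hi : i ∈ I) : cs.simple i ∈ cs.parabolic I :=
  Subgroup.subset_closure ⟨i, hi, rfl⟩

lemma exists_word_of_mem_parabolic {w : W} (hw : w ∈ cs.parabolic I) :
    ∃ ω : List B, (∀ i ∈ ω, i ∈ I) ∧ w = cs.wordProd ω := by
  induction hw using Subgroup.closure_induction with
  | mem x hx =>
    obtain ⟨i, hi, rfl⟩ := hx
    exact ⟨[i], by simpa using hi, by simp⟩
  | one => exact ⟨[], by simp, by simp⟩
  | mul x y _ _ hx hy =>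
    obtain ⟨ω, hω, rfl⟩ := hx
    obtain ⟨ω', hω', rfl⟩ := hy
    refine ⟨ω ++ ω', fun i hi => ?_, (cs.wordProd_append _ _).symm⟩
    exact (List.mem_append.1 hi).elim (hω i) (hω' i)
  | inv x _ hx =>
    obtain ⟨ω, hω, rfl⟩ := hx
    exact ⟨ω.reverse, fun i hi => hω i (List.mem_reverse.1 hi), (cs.wordProd_reverse ω).symm⟩

lemma mem_parabolic_of_mem_leftInvSeq {ω : List B} (hω : ∀ i ∈ ω, i ∈ I) {t : W}
    (ht : t ∈ cs.leftInvSeq ω) : t ∈ cs.parabolic I := by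
  induction ω generalizing t with
  | nil => simp at ht
  | cons i ω ih =>
    have hi : cs.simple i ∈ cs.parabolic I := simple_mem_parabolic (hω i (by simp))
    rw [leftInvSeq, List.mem_cons, List.mem_map] at ht
    rcases ht with rfl | ⟨u, hu, rfl⟩
    · exact hi
    · have hu := ih (fun j hj => hω j (by simp [hj])) hu
      exact mul_mem (mul_mem hi hu) (inv_mem hi)

lemma conj_mem_parabolic {a b : W} {i : B} (hb : b ∈ cs.parabolic I)
    (ha : ¬ cs.IsLeftDescent a i) (h : cs.IsLeftDescent (a * b) i) :
    a⁻¹ * cs.simple i * a ∈ cs.parabolic I := by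
  obtain ⟨ω, hω, rfl⟩ := exists_word_of_mem_parabolic hb
  exact mem_parabolic_of_mem_leftInvSeq hω (conj_mem_leftInvSeq cs ha h)

lemma IsLeftDescent.simple_mem_parabolic {w : W} {i : B} (hw : w ∈ cs.parabolic I)
    (h : cs.IsLeftDescent w i) : cs.simple i ∈ cs.parabolic I := by
  simpa using conj_mem_parabolic (a := 1) hw (cs.not_isLeftDescent_one i) (by simpa using h)

lemma mem_parabolic_left_of_length_mul {a b : W} (h : a * b ∈ cs.parabolic I)
    (hl : cs.length (a * b) = cs.length a + cs.length b) : a ∈ cs.parabolic I := by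
  induction hn : cs.length a generalizing a with
  | zero => rw [cs.length_eq_zero_iff.1 hn]; exact one_mem _
  | succ n ih =>
    obtain ⟨i, hi⟩ := cs.exists_leftDescent_of_ne_one (w := a) (by rintro rfl; simp at hn)
    rw [isLeftDescent_iff] at hi
    have hle := cs.length_mul_le (cs.simple i * a) b
    rw [mul_assoc] at hle
    have hd : cs.IsLeftDescent (a * b) i := by
      rw [IsLeftDescent]; omega
    have hs := IsLeftDescent.simple_mem_parabolic h hd
    rw [isLeftDescent_iff] at hd
    have := ih (a := cs.simple i * a) (by rw [mul_assoc]; exact mul_mem hs h)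
      (by rw [mul_assoc]; omega) (by omega)
    simpa using mul_mem hs this

lemma mem_parabolic_right_of_length_mul {a b : W} (h : a * b ∈ cs.parabolic I)
    (hl : cs.length (a * b) = cs.length a + cs.length b) : b ∈ cs.parabolic I := by
  have ha := mem_parabolic_left_of_length_mul h hl
  simpa using mul_mem (inv_mem ha) h

variable (cs) in
/-- `w` has minimal length in the coset `H w`. -/
def IsLeftMin (H : Subgroup W) (w : W) : Prop := ∀ u ∈ H, cs.length w ≤ cs.length (u * w)

variable (cs) in
/-- `w` has minimal length in the coset `w H`. -/
def IsRightMin (H : Subgroup W) (w : W) : Prop := ∀ u ∈ H, cs.length w ≤ cs.length (w * u)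

lemma isRightMin_iff_inv {H : Subgroup W} {w : W} :
    cs.IsRightMin H w ↔ cs.IsLeftMin H w⁻¹ := by
  constructor
  · intro h u hu
    rw [← cs.length_inv (u * w⁻¹)]
    simpa using h u⁻¹ (inv_mem hu)
  · intro h u hu
    rw [← cs.length_inv (w * u)]
    simpa using h u⁻¹ (inv_mem hu)

lemma IsLeftMin.length_mul {w u : W} (h : cs.IsLeftMin (cs.parabolic I) w)
    (hu : u ∈ cs.parabolic I) : cs.length (u * w) = cs.length u + cs.length w := by
  induction hn : cs.length u generalizing u with
  | zero => simp [cs.length_eq_zero_iff.1 hn]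
  | succ n ih =>
    obtain ⟨i, hi⟩ := cs.exists_leftDescent_of_ne_one (w := u) (by rintro rfl; simp at hn)
    have hs := IsLeftDescent.simple_mem_parabolic hu hi
    obtain ⟨v, rfl⟩ : ∃ v, u = cs.simple i * v := ⟨cs.simple i * u, by simp⟩
    have hv : v ∈ cs.parabolic I := by simpa using mul_mem hs hu
    rw [isLeftDescent_iff, simple_mul_simple_cancel_left] at hi
    have hlen := ih hv (by omega)
    have hnd : ¬ cs.IsLeftDescent v i := by rw [IsLeftDescent]; omega
    rcases cs.length_simple_mul (v * w) i with h1 | h1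
    · rw [mul_assoc]; omega
    · obtain ⟨ω, hω, rfl⟩ := cs.exists_isReduced w
      have ht := conj_mem_leftInvSeq cs hnd (isLeftDescent_iff cs |>.2 h1)
      have h2 := (cs.isLeftInversion_of_mem_leftInvSeq hω ht).2
      exact absurd (h _ (mul_mem (mul_mem (inv_mem hv) hs) hv)) (by omega)

lemma IsRightMin.length_mul {w u : W} (h : cs.IsRightMin (cs.parabolic I) w)
    (hu : u ∈ cs.parabolic I) : cs.length (w * u) = cs.length w + cs.length u := by
  have := (isRightMin_iff_inv.1 h).length_mul (inv_mem hu)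
  rw [← mul_inv_rev, length_inv, length_inv, length_inv] at this
  omega

lemma exists_isLeftMin (I : Set B) (w : W) : ∃ u ∈ cs.parabolic I, ∃ x,
    cs.IsLeftMin (cs.parabolic I) x ∧ w = u * x ∧
      cs.length w = cs.length u + cs.length x := by
  obtain ⟨u, hu⟩ := exists_minimal_le_of_wellFoundedLT
    (fun n => ∃ u ∈ cs.parabolic I, cs.length (u * w) = n) (cs.length w)
    ⟨1, one_mem _, by simp⟩
  obtain ⟨-, ⟨⟨v, hv, hvu⟩, hmin⟩⟩ := hu
  have hm : cs.IsLeftMin (cs.parabolic I) (v * w) := by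
    intro x hx
    rcases le_total u (cs.length (x * (v * w))) with h | h
    · exact hvu.trans_le h
    · exact hvu.trans_le (hmin ⟨x * v, mul_mem hx hv, by rw [mul_assoc]⟩ h)
  refine ⟨v⁻¹, inv_mem hv, v * w, hm, by simp, ?_⟩
  simpa using hm.length_mul (inv_mem hv)

lemma exists_isRightMin (I : Set B) (w : W) : ∃ x, ∃ u ∈ cs.parabolic I,
    cs.IsRightMin (cs.parabolic I) x ∧ w = x * u ∧
      cs.length w = cs.length x + cs.length u := by
  obtain ⟨u, hu, x, hx, hw, hl⟩ := cs.exists_isLeftMin I w⁻¹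
  refine ⟨x⁻¹, u⁻¹, inv_mem hu, isRightMin_iff_inv.2 (by simpa using hx), ?_, ?_⟩
  · rw [← mul_inv_rev, ← hw, inv_inv]
  · rw [length_inv, length_inv, ← cs.length_inv w, hl, add_comm]

lemma IsLeftMin.of_mul {H : Subgroup W} {c y : W} (h : cs.IsLeftMin H (c * y))
    (hl : cs.length (c * y) = cs.length c + cs.length y) : cs.IsLeftMin H c := by
  intro u hu
  have h1 := h u hu
  have h2 := cs.length_mul_le (u * c) y
  rw [mul_assoc] at h2
  omega

lemma exists_doubleCoset_min (I J : Set B) (w : W) : ∃ a ∈ cs.parabolic I, ∃ c,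
    ∃ b ∈ cs.parabolic J, cs.IsLeftMin (cs.parabolic I) c ∧ cs.IsRightMin (cs.parabolic J) c ∧
      w = a * c * b ∧ cs.length w = cs.length a + cs.length c + cs.length b := by
  obtain ⟨a, ha, x, hx, rfl, hl⟩ := cs.exists_isLeftMin I w
  obtain ⟨c, b, hb, hc, rfl, hl'⟩ := cs.exists_isRightMin J x
  exact ⟨a, ha, c, b, hb, hx.of_mul hl', hc, by rw [mul_assoc], by omega⟩

lemma eq_of_mul_eq_mul_of_min {c d p q : W} (hc : cs.IsLeftMin (cs.parabolic I) c)
    (hc' : cs.IsRightMin (cs.parabolic J) c) (hd : cs.IsLeftMin (cs.parabolic I) d)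
    (hd' : cs.IsRightMin (cs.parabolic J) d) (hp : p ∈ cs.parabolic I)
    (hq : q ∈ cs.parabolic J) (h : p * d = c * q) : c = d := by
  induction hn : cs.length p generalizing p q with
  | zero =>
    rw [cs.length_eq_zero_iff.1 hn, one_mul] at h
    have h1 := hc'.length_mul hq
    have h2 := hd' q⁻¹ (inv_mem hq)
    rw [h, mul_inv_cancel_right] at h2
    have h3 : q = 1 := cs.length_eq_zero_iff.1 (by omega)
    rw [h, h3, mul_one]
  | succ n ih =>
    obtain ⟨i, hi⟩ := cs.exists_leftDescent_of_ne_one (w := p) (by rintro rfl; simp at hn)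
    have hs := IsLeftDescent.simple_mem_parabolic hp hi
    rw [isLeftDescent_iff] at hi
    have hdesc : cs.IsLeftDescent (c * q) i := by
      rw [IsLeftDescent, ← h, ← mul_assoc, hd.length_mul (mul_mem hs hp), hd.length_mul hp]
      omega
    have hnd : ¬ cs.IsLeftDescent c i := not_lt.2 (hc _ hs)
    exact ih (mul_mem hs hp) (mul_mem (conj_mem_parabolic hq hnd hdesc) hq)
      (by simp [mul_assoc, h]) (by omega)

lemma mem_parabolic_of_mul_mul_mem {c p q : W} (hc : cs.IsLeftMin (cs.parabolic I) c)
    (hc' : cs.IsRightMin (cs.parabolic J) c) (hp : p ∈ cs.parabolic I)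
    (hq : q ∈ cs.parabolic J) (h : p * c * q ∈ cs.parabolic K) : c ∈ cs.parabolic K := by
  obtain ⟨a, ha, d, b, hb, hd, hd', hw, hl⟩ := cs.exists_doubleCoset_min I J (p * c * q)
  have hcd : d = c := by
    refine eq_of_mul_eq_mul_of_min hd hd' hc hc' (mul_mem (inv_mem ha) hp)
      (mul_mem hb (inv_mem hq)) ?_
    rw [mul_assoc, inv_mul_eq_iff_eq_mul, ← mul_assoc, ← mul_assoc, ← hw, mul_inv_cancel_right]
  subst hcd
  rw [hw] at h hl
  have h1 := cs.length_mul_le (a * d) b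
  have h2 := cs.length_mul_le a d
  exact mem_parabolic_right_of_length_mul
    (mem_parabolic_left_of_length_mul h (by omega)) (by omega)

/-- Left multiplication by a simple reflection is weakly compatible with passing to minimal
representatives of left cosets. -/
lemma IsRightMin.length_le_of_simple_mul {w x y u v : W} {i : B}
    (hx : cs.IsRightMin (cs.parabolic I) x) (hy : cs.IsRightMin (cs.parabolic I) y)
    (hu : u ∈ cs.parabolic I) (hv : v ∈ cs.parabolic I) (hw : w = x * u)
    (hw' : cs.simple i * w = y * v) (h : cs.IsLeftDescent w i) :
    cs.length y ≤ cs.length x := by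
  have hyx : y = cs.simple i * x * (u * v⁻¹) := by
    rw [← mul_assoc, mul_assoc _ x, ← hw, hw', mul_inv_cancel_right]
  by_contra! hlt
  have hle (z : W) (hz : z ∈ cs.parabolic I) :
      cs.length y ≤ cs.length (cs.simple i * x * z) := by
    have := hy ((u * v⁻¹)⁻¹ * z) (mul_mem (inv_mem (mul_mem hu (inv_mem hv))) hz)
    rwa [← mul_assoc, ← eq_mul_inv_of_mul_eq hyx.symm] at this
  have hsx : cs.IsRightMin (cs.parabolic I) (cs.simple i * x) := by
    intro z hz
    have := hle z hz
    rcases cs.length_simple_mul x i with h1 | h1 <;> omega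
  have h1 := hle 1 (one_mem _)
  rw [mul_one] at h1
  rw [IsLeftDescent, hw, ← mul_assoc, hsx.length_mul hu, hx.length_mul hu] at h
  omega

end CoxeterSystem

namespace GRCSystem

open CoxeterSystem

variable {B R : Type*} [Monoid R] {G : GRCSystem B R} {e f h : R}

lemma isIdempotentElem_conj (he : IsIdempotentElem e) (w : Rˣ) :
    IsIdempotentElem ((w : R) * e * ((w⁻¹ : Rˣ) : R)) := by
  have he' (x : R) : e * (e * x) = e * x := by rw [← mul_assoc, he.eq]
  simp [IsIdempotentElem, mul_assoc, he']

lemma eq_of_conj_eq_conj (he : e ∈ G.Λ) (hf : f ∈ G.Λ) {v w : Rˣ}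
    (h : (v : R) * e * ((v⁻¹ : Rˣ) : R) = (w : R) * f * ((w⁻¹ : Rˣ) : R)) : e = f :=
  (G.transversal _ (isIdempotentElem_conj (G.lam_idem f hf) w)).unique
    ⟨he, v, h⟩ ⟨hf, w, rfl⟩

lemma mem_parab_lam (he : e ∈ G.Λ) {w : Rˣ} :
    w ∈ G.cs.parabolic (G.lam e) ↔ (w : R) * e = e * (w : R) :=
  (G.mem_lam_iff e he w).symm

lemma inv_mul_mem_parab_lam (he : e ∈ G.Λ) {v w : Rˣ}
    (h : (v : R) * e * ((v⁻¹ : Rˣ) : R) = (w : R) * e * ((w⁻¹ : Rˣ) : R)) :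
    v⁻¹ * w ∈ G.cs.parabolic (G.lam e) := by
  rw [mem_parab_lam he, Units.val_mul, mul_assoc, Units.inv_mul_eq_iff_eq_mul,
    ← mul_assoc, ← mul_assoc, h, mul_assoc _ _ (w : R), Units.inv_mul, mul_one]

lemma mem_parab_lamStar (he : e ∈ G.Λ) {w : Rˣ} :
    w ∈ G.cs.parabolic (G.lamStar e) ↔ (w : R) * e = e ∧ e * (w : R) = e :=
  (G.mem_lamStar_iff e he w).symm

lemma parab_lamStar_le (he : e ∈ G.Λ) :
    G.cs.parabolic (G.lamStar e) ≤ G.cs.parabolic (G.lam e) := fun w hw => by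
  obtain ⟨h1, h2⟩ := (mem_parab_lamStar he).1 hw
  exact (mem_parab_lam he).2 (h1.trans h2.symm)

lemma mem_parab_lamStar_of_mul_eq (he : e ∈ G.Λ) {w : Rˣ} (h : e * (w : R) = e) :
    w ∈ G.cs.parabolic (G.lamStar e) := by
  have hei := G.lam_idem e he
  have hpi := isIdempotentElem_conj hei w⁻¹
  rw [inv_inv, mul_assoc, h] at hpi
  have h1 : e * (((w⁻¹ : Rˣ) : R) * e) = ((w⁻¹ : Rˣ) : R) * e := by
    rw [G.idem_mul_comm _ _ hei hpi, mul_assoc, hei.eq]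
  have h2 : e * (((w⁻¹ : Rˣ) : R) * e) = e := by
    have := congrArg (fun x => (w : R) * x) hpi.eq
    simpa [mul_assoc] using this
  exact (mem_parab_lamStar he).2 ⟨(Units.inv_mul_eq_iff_eq_mul w).1 (h1.symm.trans h2) |>.symm, h⟩

lemma one_mem_Λ (G : GRCSystem B R) : (1 : R) ∈ G.Λ := by
  obtain ⟨f, ⟨hf, w, hw⟩, -⟩ := G.transversal 1 (by simp [IsIdempotentElem])
  rw [Units.mul_inv_eq_iff_eq_mul, one_mul] at hw
  have : f = 1 := by simpa using congrArg (fun x => ((w⁻¹ : Rˣ) : R) * x) hw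
  exact this ▸ hf

lemma exists_conj_of_le {x : R} (hx : IsIdempotentElem x) (he : e ∈ G.Λ) (hxe : x * e = x) :
    ∃ v ∈ G.cs.parabolic (G.lam e), ∃ h ∈ G.Λ,
      h * e = h ∧ (v : R) * h * ((v⁻¹ : Rˣ) : R) = x := by
  have hei := G.lam_idem e he
  obtain ⟨v, h, e', hh, he', hhe, -, hvh, hve⟩ :=
    G.ecs4 x e hx hei hxe ((G.idem_mul_comm e x hei hx).trans hxe)
  obtain rfl : e' = e := eq_of_conj_eq_conj he' he (v := v) (w := 1) (by simp [hve])
  exact ⟨v, (mem_parab_lam he).2 ((Units.mul_inv_eq_iff_eq_mul v).1 hve), h, hh, hhe, hvh⟩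

lemma conj_eq_of_le (hh : h ∈ G.Λ) {v : Rˣ}
    (hle : h * ((v : R) * h * ((v⁻¹ : Rˣ) : R)) = h) :
    (v : R) * h * ((v⁻¹ : Rˣ) : R) = h := by
  have hi := G.lam_idem h hh
  have hvi := isIdempotentElem_conj hi v
  obtain ⟨w, f₁, f₂, hf₁, hf₂, -, -, h₁, h₂⟩ :=
    G.ecs4 h _ hi hvi hle ((G.idem_mul_comm _ _ hvi hi).trans hle)
  obtain rfl : f₁ = h := eq_of_conj_eq_conj hf₁ hh (v := w) (w := 1) (by simp [h₁])
  obtain rfl : f₂ = f₁ := eq_of_conj_eq_conj hf₂ hh h₂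
  rw [← h₂, h₁]

lemma exists_mul_of_mem_parab_lam (hh : h ∈ G.Λ) {w : Rˣ}
    (hw : w ∈ G.cs.parabolic (G.lam h)) :
    ∃ a ∈ G.cs.parabolic (G.lamCostar h), ∃ n ∈ G.cs.parabolic (G.lamStar h), w = a * n := by
  obtain ⟨ω, hω, rfl⟩ := exists_word_of_mem_parabolic hw
  clear hw
  induction ω with
  | nil => exact ⟨1, one_mem _, 1, one_mem _, by simp⟩
  | cons i ω ih =>
    obtain ⟨a, ha, n, hn, han⟩ := ih fun j hj => hω j (by simp [hj])
    have hi : (G.cs.simple i : R) * h = h * (G.cs.simple i : R) :=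
      (mem_parab_lam hh).1 (simple_mem_parabolic (hω i (by simp)))
    rw [wordProd_cons, han]
    by_cases his : (G.cs.simple i : R) * h = h
    · have hah : (a : R) * h = h * (a : R) := by
        rw [← mem_parab_lam hh]
        refine (Subgroup.closure_le _).2 ?_ ha
        rintro _ ⟨j, hj, rfl⟩
        exact (mem_parab_lam hh).2 hj.1
      refine ⟨a, ha, a⁻¹ * G.cs.simple i * a * n, mul_mem ?_ hn, by simp [mul_assoc]⟩
      have hah' : ((a⁻¹ : Rˣ) : R) * h = h * ((a⁻¹ : Rˣ) : R) := by
        rw [Units.inv_mul_eq_iff_eq_mul, ← mul_assoc, hah, Units.mul_inv_cancel_right]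
      rw [mem_parab_lamStar hh]
      push_cast
      constructor
      · rw [mul_assoc, hah, mul_assoc, ← mul_assoc _ h, his, ← hah, Units.inv_mul_cancel_left]
      · rw [← mul_assoc, ← mul_assoc, ← hah', mul_assoc _ h, ← hi, his, mul_assoc, ← hah,
          Units.inv_mul_cancel_left]
    · exact ⟨G.cs.simple i * a, mul_mem (simple_mem_parabolic ⟨hi, his⟩) ha, n, hn,
        by rw [mul_assoc]⟩

/-- For `h ≤ e` in `Λ`, an element of `W(h)` which cannot be shortened by left multiplication by
`W(e) ∩ W(h)` lies in `W_⋆(h)`. -/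
lemma mem_parab_lamStar_of_min (he : e ∈ G.Λ) (hh : h ∈ G.Λ) (hle : h * e = h) {w : Rˣ}
    (hw : w ∈ G.cs.parabolic (G.lam h))
    (hmin : ∀ u ∈ G.cs.parabolic (G.lam e), u ∈ G.cs.parabolic (G.lam h) →
      G.cs.length w ≤ G.cs.length (u * w)) :
    w ∈ G.cs.parabolic (G.lamStar h) := by
  have hsub : G.cs.parabolic (G.lamCostar h) ≤
      G.cs.parabolic (G.lam e) ⊓ G.cs.parabolic (G.lam h) := by
    refine (Subgroup.closure_le _).2 ?_
    rintro _ ⟨i, hi, rfl⟩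
    exact ⟨(mem_parab_lam he).2 (G.ecs6 h hh e he hle i hi).1, (mem_parab_lam hh).2 hi.1⟩
  have hlm : G.cs.IsLeftMin (G.cs.parabolic (G.lamCostar h)) w :=
    fun u hu => hmin u (hsub hu).1 (hsub hu).2
  obtain ⟨a, ha, n, hn, rfl⟩ := exists_mul_of_mem_parab_lam hh hw
  have hl := hlm.length_mul (inv_mem ha)
  exact mem_parabolic_right_of_length_mul (a := a⁻¹) (by simpa using hn) hl

/-- If `c` is `(λ(e), λ(f))`-reduced then `e c f` is an element of `Λ` fixed by `c`. -/
lemma exists_mul_mul_eq (he : e ∈ G.Λ) (hf : f ∈ G.Λ) {c : Rˣ}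
    (hc : G.cs.IsLeftMin (G.cs.parabolic (G.lam e)) c)
    (hc' : G.cs.IsRightMin (G.cs.parabolic (G.lam f)) c) :
    ∃ h ∈ G.Λ, e * (c : R) * f = h ∧ h * e = h ∧ (c : R) * h = h ∧ h * (c : R) = h := by
  have hei := G.lam_idem e he
  have hfi := G.lam_idem f hf
  have hcf := isIdempotentElem_conj hfi c
  have hcomm := G.idem_mul_comm _ _ hei hcf
  set x := e * ((c : R) * f * ((c⁻¹ : Rˣ) : R)) with hx
  have hxi : IsIdempotentElem x := hei.mul_of_commute hcomm hcf
  obtain ⟨v, hv, h, hh, hhe, hvx⟩ := exists_conj_of_le hxi he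
    (by rw [hcomm, mul_assoc, hei.eq])
  obtain ⟨u, hu, h', hh', hhf, hux⟩ := exists_conj_of_le (x := ((c⁻¹ : Rˣ) : R) * x * c)
    (by simpa using isIdempotentElem_conj hxi c⁻¹) hf
    (by simp [hx, mul_assoc, hfi.eq])
  have hcux : ((c * u : Rˣ) : R) * h' * (((c * u)⁻¹ : Rˣ) : R) = x := by
    calc ((c * u : Rˣ) : R) * h' * (((c * u)⁻¹ : Rˣ) : R)
        = (c : R) * ((u : R) * h' * ((u⁻¹ : Rˣ) : R)) * ((c⁻¹ : Rˣ) : R) := by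
          simp [mul_assoc]
      _ = x := by rw [hux]; simp [mul_assoc]
  obtain rfl : h' = h := eq_of_conj_eq_conj hh' hh (hcux.trans hvx.symm)
  have hmem : v⁻¹ * c * u ∈ G.cs.parabolic (G.lam h') := by
    rw [mul_assoc]
    exact inv_mul_mem_parab_lam hh (hvx.trans hcux.symm)
  have hch := mem_parabolic_of_mul_mul_mem hc hc' (inv_mem hv) hu hmem
  have hcs := mem_parab_lamStar_of_min he hh hhe hch fun w hw _ => hc w hw
  obtain ⟨h1, h2⟩ := (mem_parab_lamStar hh).1 hcs
  have h3 := ((mem_parab_lamStar hh).1 (inv_mem hcs)).2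
  have hxh : x = h' := by
    rw [← hvx]
    refine conj_eq_of_le hh ?_
    rw [hvx, hx, ← mul_assoc, ← mul_assoc, ← mul_assoc, hhe, h2, hhf, h3]
  refine ⟨h', hh, ?_, hhe, h1, h2⟩
  calc e * (c : R) * f = x * c := by simp [hx, mul_assoc]
    _ = h' := by rw [hxh, h2]

lemma wordLen_append {B R : Type*} (l l' : List (B ⊕ R)) :
    wordLen (l ++ l') = wordLen l + wordLen l' := by
  simp [wordLen]

lemma exists_mul_mul_of_isWord {l : List (B ⊕ R)} (hl : G.IsWord l) :
    ∃ (a : Rˣ) (e : R) (b : Rˣ), e ∈ G.Λ ∧ (l.map G.letterVal).prod = (a : R) * e * (b : R) ∧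
      G.cs.length a + G.cs.length b ≤ wordLen l := by
  induction l with
  | nil => exact ⟨1, 1, 1, G.one_mem_Λ, by simp, by simp⟩
  | cons x l ih =>
    obtain ⟨a, e, b, he, hprod, hlen⟩ := ih fun f hf => hl f (by simp [hf])
    rw [List.map_cons, List.prod_cons, hprod]
    cases x with
    | inl i =>
      refine ⟨G.cs.simple i * a, e, b, he, by simp [letterVal, mul_assoc], ?_⟩
      have h1 := G.cs.length_mul_le (G.cs.simple i) a
      rw [G.cs.length_simple] at h1
      have h2 : wordLen (Sum.inl i :: l) = wordLen l + 1 := by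
        simp [wordLen, List.filter_cons]
      omega
    | inr f =>
      obtain ⟨hf, -⟩ := hl f (by simp)
      obtain ⟨x, hx, c, y, hy, hc, hc', rfl, hlen'⟩ :=
        G.cs.exists_doubleCoset_min (G.lam f) (G.lam e) a
      obtain ⟨h, hh, hfce, -⟩ := exists_mul_mul_eq hf he hc hc'
      have hxf := (mem_parab_lam hf).1 hx
      have hye := (mem_parab_lam he).1 hy
      refine ⟨x, h, y * b, hh, ?_, ?_⟩
      · calc f * (((x * c * y : Rˣ) : R) * e * b)
            = (f * x) * c * (y * e) * b := by simp [mul_assoc]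
          _ = x * (f * c * e) * ((y * b : Rˣ) : R) := by
            rw [← hxf, hye]; simp [mul_assoc]
          _ = x * h * ((y * b : Rˣ) : R) := by rw [hfce]
      · have h1 := G.cs.length_mul_le y b
        have h2 : wordLen (Sum.inr f :: l) = wordLen l := by simp [wordLen]
        omega

lemma exists_isWord (a b : Rˣ) (he : e ∈ G.Λ) : ∃ l : List (B ⊕ R), G.IsWord l ∧
    (l.map G.letterVal).prod = (a : R) * e * (b : R) ∧
      wordLen l = G.cs.length a + G.cs.length b := by
  have key (w : Rˣ) : ∃ l : List (B ⊕ R), G.IsWord l ∧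
      (l.map G.letterVal).prod = (w : R) ∧ wordLen l = G.cs.length w := by
    obtain ⟨ω, hω, rfl⟩ := G.cs.exists_isReduced w
    refine ⟨ω.map Sum.inl, by simp [IsWord], ?_, ?_⟩
    · rw [← Units.coeHom_apply, wordProd, map_list_prod, List.map_map, List.map_map]
      rfl
    · rw [hω.eq, wordLen, List.filter_eq_self.2 (by simp), List.length_map]
  obtain ⟨l, hl, hlp, hll⟩ := key a
  obtain ⟨l', hl', hlp', hll'⟩ := key b
  obtain ⟨m, hm, hmp, hml⟩ : ∃ m : List (B ⊕ R), G.IsWord m ∧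
      (m.map G.letterVal).prod = e ∧ wordLen m = 0 := by
    by_cases h1 : e = 1
    · exact ⟨[], by simp [IsWord], by simp [h1], by simp [wordLen]⟩
    · exact ⟨[Sum.inr e], by simp [IsWord, he, h1], by simp [letterVal], by simp [wordLen]⟩
  refine ⟨l ++ m ++ l', fun f hf => ?_, by simp [hlp, hmp, hlp', mul_assoc], ?_⟩
  · simp only [List.mem_append] at hf
    rcases hf with (hf | hf) | hf
    exacts [hl f hf, hm f hf, hl' f hf]
  · rw [wordLen_append, wordLen_append]
    omega

lemma exists_eq_mul_mul (G : GRCSystem B R) (r : R) :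
    ∃ (a : Rˣ) (e : R) (b : Rˣ), e ∈ G.Λ ∧ r = (a : R) * e * (b : R) := by
  obtain ⟨e, g, he, rfl⟩ := G.factor r
  obtain ⟨f, ⟨hf, w, rfl⟩, -⟩ := G.transversal e he
  exact ⟨w, f, w⁻¹ * g, hf, by simp [mul_assoc]⟩

lemma len_mul_mul_le (a b : Rˣ) (he : e ∈ G.Λ) :
    G.len ((a : R) * e * (b : R)) ≤ G.cs.length a + G.cs.length b := by
  obtain ⟨l, hl, hlp, hll⟩ := exists_isWord a b he
  exact Nat.sInf_le ⟨l, hl, hlp, hll.symm⟩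

lemma exists_length_add_length_le_len (G : GRCSystem B R) (r : R) :
    ∃ (a : Rˣ) (e : R) (b : Rˣ), e ∈ G.Λ ∧ r = (a : R) * e * (b : R) ∧
      G.cs.length a + G.cs.length b ≤ G.len r := by
  obtain ⟨a, e, b, he, hr⟩ := G.exists_eq_mul_mul r
  obtain ⟨l, hl, hlp, hll⟩ := exists_isWord a b he
  obtain ⟨m, hm, hmp, hml⟩ := Nat.sInf_mem (s := {n : ℕ | ∃ l : List (B ⊕ R), G.IsWord l ∧
    (l.map G.letterVal).prod = r ∧ n = wordLen l}) ⟨_, l, hl, hlp.trans hr.symm, rfl⟩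
  obtain ⟨a', e', b', he', hp, hle⟩ := exists_mul_mul_of_isWord hm
  refine ⟨a', e', b', he', hmp.symm.trans hp, hle.trans_eq hml.symm⟩

lemma eq_of_mul_units_eq {p q : R} (hp : IsIdempotentElem p) (hq : IsIdempotentElem q)
    (hpq : p * q = q * p) {g g' : Rˣ} (h : p * (g : R) = q * (g' : R)) : p = q := by
  have h1 : p = q * ((g' : R) * ((g⁻¹ : Rˣ) : R)) := by
    rw [← mul_assoc, ← h, Units.mul_inv_cancel_right]
  have h2 : q = p * ((g : R) * ((g'⁻¹ : Rˣ) : R)) := by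
    rw [← mul_assoc, h, Units.mul_inv_cancel_right]
  have h3 : q * p = p := by
    conv_lhs => rw [h1]
    rw [← mul_assoc, hq.eq, ← h1]
  have h4 : p * q = q := by
    conv_lhs => rw [h2]
    rw [← mul_assoc, hp.eq, ← h2]
  rw [← h3, ← hpq, h4]

/-- The length of `r` is the sum of the lengths of the unit parts of its normal decomposition. -/
lemma len_eq_of_min {x z : Rˣ} (he : e ∈ G.Λ)
    (hx : G.cs.IsRightMin (G.cs.parabolic (G.lamStar e)) x)
    (hz : G.cs.IsLeftMin (G.cs.parabolic (G.lam e)) z) :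
    G.len ((x : R) * e * (z : R)) = G.cs.length x + G.cs.length z := by
  refine (len_mul_mul_le x z he).antisymm ?_
  obtain ⟨a, e', b, he', hr, hle⟩ := G.exists_length_add_length_le_len ((x : R) * e * (z : R))
  have hconj : (x : R) * e * ((x⁻¹ : Rˣ) : R) = (a : R) * e' * ((a⁻¹ : Rˣ) : R) := by
    have h1 := isIdempotentElem_conj (G.lam_idem e he) x
    have h2 := isIdempotentElem_conj (G.lam_idem e' he') a
    refine eq_of_mul_units_eq h1 h2 (G.idem_mul_comm _ _ h1 h2) (g := x * z) (g' := a * b) ?_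
    simpa [mul_assoc] using hr
  obtain rfl : e = e' := eq_of_conj_eq_conj he he' hconj
  have hu := inv_mul_mem_parab_lam he hconj
  have hn : x⁻¹ * a * (b * z⁻¹) ∈ G.cs.parabolic (G.lamStar e) := by
    refine mem_parab_lamStar_of_mul_eq he ?_
    calc e * ((x⁻¹ * a * (b * z⁻¹) : Rˣ) : R)
        = e * ((x⁻¹ * a : Rˣ) : R) * b * ((z⁻¹ : Rˣ) : R) := by simp [mul_assoc]
      _ = ((x⁻¹ : Rˣ) : R) * ((a : R) * e * b) * ((z⁻¹ : Rˣ) : R) := by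
        rw [← (mem_parab_lam he).1 hu]; simp [mul_assoc]
      _ = e := by rw [← hr]; simp [mul_assoc]
  have hv : b * z⁻¹ ∈ G.cs.parabolic (G.lam e) := by
    simpa only [inv_mul_cancel_left] using mul_mem (inv_mem hu) (parab_lamStar_le he hn)
  have h1 := hx _ hn
  have h2 := hz.length_mul hv
  have h3 := G.cs.length_mul_le a (b * z⁻¹)
  rw [mul_assoc, mul_inv_cancel_left] at h1
  rw [inv_mul_cancel_right] at h2
  omega

lemma len_simple_mul_le {i : B} {w z : Rˣ} (he : e ∈ G.Λ)
    (hz : G.cs.IsLeftMin (G.cs.parabolic (G.lam e)) z) (hw : G.cs.IsLeftDescent w i) :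
    G.len ((G.cs.simple i : R) * ((w : R) * e * (z : R))) ≤ G.len ((w : R) * e * (z : R)) := by
  have key (v : Rˣ) : ∃ x, ∃ u ∈ G.cs.parabolic (G.lamStar e),
      G.cs.IsRightMin (G.cs.parabolic (G.lamStar e)) x ∧ v = x * u ∧
        G.len ((v : R) * e * (z : R)) = G.cs.length x + G.cs.length z := by
    obtain ⟨x, u, hu, hx, rfl, -⟩ := G.cs.exists_isRightMin (G.lamStar e) v
    refine ⟨x, u, hu, hx, rfl, ?_⟩
    rw [Units.val_mul, mul_assoc (x : R), ((mem_parab_lamStar he).1 hu).1, len_eq_of_min he hx hz]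
  obtain ⟨x, u, hu, hx, hxu, hlx⟩ := key w
  obtain ⟨y, v, hv, hy, hyv, hly⟩ := key (G.cs.simple i * w)
  have := hx.length_le_of_simple_mul hy hu hv hxu hyv hw
  rw [Units.val_mul, mul_assoc, mul_assoc, ← mul_assoc (w : R)] at hly
  omega

lemma len_le_len_simple_mul {i : B} {w z : Rˣ} (he : e ∈ G.Λ)
    (hz : G.cs.IsLeftMin (G.cs.parabolic (G.lam e)) z) (hw : ¬ G.cs.IsLeftDescent w i) :
    G.len ((w : R) * e * (z : R)) ≤ G.len ((G.cs.simple i : R) * ((w : R) * e * (z : R))) := by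
  have hw' : G.cs.IsLeftDescent (G.cs.simple i * w) i := by
    rw [isLeftDescent_iff_not_isLeftDescent_mul, simple_mul_simple_cancel_left]
    exact hw
  have := len_simple_mul_le he hz hw'
  rw [← mul_assoc, ← mul_assoc, ← Units.val_mul, simple_mul_simple_cancel_left] at this
  rwa [← mul_assoc, ← mul_assoc, ← Units.val_mul]

/-- Right multiplication of `w₁ e w₂` by `f ∈ Λ` only affects the part `e w₂`, and `e w₂ f` has the
form `h y = h z` where `y` and `z` are right factors of `w₂`. -/
lemma exists_mul_mul_eq_mul (he : e ∈ G.Λ) (hf : f ∈ G.Λ) {w : Rˣ}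
    (hw : G.cs.IsLeftMin (G.cs.parabolic (G.lam e)) w) :
    ∃ h ∈ G.Λ, ∃ c, ∃ y ∈ G.cs.parabolic (G.lam f), ∃ z : Rˣ, w = c * y ∧
      G.cs.length w = G.cs.length c + G.cs.length y ∧
      e * (w : R) * f = h * (y : R) ∧ h * (y : R) = h * (z : R) ∧
      G.cs.IsLeftMin (G.cs.parabolic (G.lam h)) z := by
  obtain ⟨c, y, hy, hc, rfl, hl⟩ := G.cs.exists_isRightMin (G.lam f) w
  obtain ⟨h, hh, hecf, hhe, -, hhc⟩ := exists_mul_mul_eq he hf (hw.of_mul hl) hc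
  obtain ⟨q, hq, z, hz, hqz, hl'⟩ := G.cs.exists_isLeftMin (G.lam h) (c * y)
  have hq' : q ∈ G.cs.parabolic (G.lamStar h) := by
    refine mem_parab_lamStar_of_min he hh hhe hq fun u hu hu' => ?_
    have h1 := hw u hu
    rw [hqz, ← mul_assoc, hz.length_mul (mul_mem hu' hq), hz.length_mul hq] at h1
    omega
  refine ⟨h, hh, c, y, hy, z, rfl, hl, ?_, ?_, hz⟩
  · rw [← hecf, Units.val_mul, mul_assoc, mul_assoc, (mem_parab_lam hf).1 hy]
    simp [mul_assoc]
  · calc h * (y : R) = h * ((c * y : Rˣ) : R) := by rw [Units.val_mul, ← mul_assoc, hhc]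
      _ = h * (z : R) := by
        rw [hqz, Units.val_mul, ← mul_assoc, ((mem_parab_lamStar hh).1 hq').2]

end GRCSystem

/-- for `r` with normal decomposition `(w₁, e, w₂)`, `f ∈ Λ` and `s ∈ S`:
if `ℓ(rf) = ℓ(r)` then `w₂ ∈ W_{λ(f)}`; if `ℓ(sr) = ℓ(r) − 1` then `ℓ(srf) ≤ ℓ(rf)`;
and if `ℓ(sr) = ℓ(r) + 1` then `ℓ(srf) ≥ ℓ(rf)`. -/
theorem len_mul_idempotent
    {B R : Type*} [Monoid R] (G : GRCSystem B R)
    (r : R) (w₁ : Rˣ) (e : R) (w₂ : Rˣ)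
    (hnd : G.IsNormalDecomp r w₁ e w₂)
    (f : R) (hf : f ∈ G.Λ) (s : B) :
    (G.len (r * f) = G.len r → w₂ ∈ G.parab (G.lam f)) ∧
    (G.len ((G.cs.simple s : R) * r) + 1 = G.len r →
      G.len ((G.cs.simple s : R) * r * f) ≤ G.len (r * f)) ∧
    (G.len ((G.cs.simple s : R) * r) = G.len r + 1 →
      G.len (r * f) ≤ G.len ((G.cs.simple s : R) * r * f)) := by
  obtain ⟨he, hw₁, hw₂, rfl⟩ := hnd
  obtain ⟨h, hh, c, y, hy, z, hcy, hl, hef, hyz, hz⟩ := GRCSystem.exists_mul_mul_eq_mul he hf hw₂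
  have hlen := GRCSystem.len_eq_of_min he hw₁ hw₂
  have hrf : (w₁ : R) * e * w₂ * f = w₁ * h * y := by
    rw [mul_assoc _ h, ← hef]
    simp only [mul_assoc]
  refine ⟨fun hr => ?_, fun hr => ?_, fun hr => ?_⟩
  · have hle := GRCSystem.len_mul_mul_le w₁ y hh
    rw [← hrf, hr] at hle
    have hc : c = 1 := G.cs.length_eq_zero_iff.1 (by omega)
    rw [hcy, hc, one_mul]
    exact hy
  · have hd : G.cs.IsLeftDescent w₁ s := by
      by_contra hd
      have := GRCSystem.len_le_len_simple_mul he hw₂ hd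
      omega
    rw [mul_assoc, hrf, mul_assoc _ h, hyz, ← mul_assoc (w₁ : R)]
    exact GRCSystem.len_simple_mul_le hh hz hd
  · have hd : ¬ G.cs.IsLeftDescent w₁ s := by
      intro hd
      have := GRCSystem.len_simple_mul_le he hw₂ hd
      omega
    rw [mul_assoc (G.cs.simple s : R) _ f, hrf, mul_assoc _ h, hyz, ← mul_assoc (w₁ : R)]
    exact GRCSystem.len_le_len_simple_mul hh hz hd
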